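/- arXiv:2508.10470 — 2 statements merged into one kernel-verified Lean document; each statement's English description precedes it below -/
import Mathlib

section
/- Let (X,d) be a metric space, D ≥ 0, and let γ : [0,1] → X satisfy d(γ(s),γ(t)) = |s − t| · D for all s, t ∈ [0,1] (a constant-speed geodesic segment). Let ρ : X × X → [0,∞) satisfy the triangle inequality ρ(x,z) ≤ ρ(x,y) + ρ(y,z) for all x,y,z ∈ X, suppose ρ(γ(0),γ(0)) = 0 and that the function t ↦ ρ(γ(0),γ(t)) is continuous on [0,1]. Let C ≥ 0 and suppose that for every t ∈ [0,1) there exists u ∈ (t,1] with ρ(γ(t),γ(u)) ≤ C · d(γ(t),γ(u)). Then ρ(γ(0),γ(1)) ≤ C · d(γ(0),γ(1)). -/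
/-- Deterministic propagation lemma along a constant-speed geodesic: if `ρ` satisfies
the triangle inequality, `t ↦ ρ(γ 0, γ t)` is continuous, `ρ(γ 0, γ 0) = 0`, and from
every time `t < 1` there is a later time `u` with `ρ(γ t, γ u) ≤ C · d(γ t, γ u)`, then
`ρ(γ 0, γ 1) ≤ C · d(γ 0, γ 1)`. -/
theorem propagate_along_geodesic {X : Type*} [MetricSpace X]
    (D : ℝ) (hD : 0 ≤ D) (γ : ℝ → X)
    (hgeo : ∀ s ∈ Set.Icc (0 : ℝ) 1, ∀ t ∈ Set.Icc (0 : ℝ) 1,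
      dist (γ s) (γ t) = |s - t| * D)
    (ρ : X → X → ℝ) (hρnn : ∀ x y, 0 ≤ ρ x y)
    (htri : ∀ x y z, ρ x z ≤ ρ x y + ρ y z)
    (h0 : ρ (γ 0) (γ 0) = 0)
    (hcont : ContinuousOn (fun t => ρ (γ 0) (γ t)) (Set.Icc 0 1))
    (C : ℝ) (hC : 0 ≤ C)
    (hstep : ∀ t ∈ Set.Ico (0 : ℝ) 1, ∃ u ∈ Set.Ioc t 1,
      ρ (γ t) (γ u) ≤ C * dist (γ t) (γ u)) :
    ρ (γ 0) (γ 1) ≤ C * dist (γ 0) (γ 1) := by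
  have dist_start : ∀ t ∈ Set.Icc (0 : ℝ) 1, dist (γ 0) (γ t) = t * D := fun t ht => by
    rw [hgeo 0 (by simp) t ht, zero_sub, abs_neg, abs_of_nonneg ht.1]
  have hclosed : IsClosed {t ∈ Set.Icc (0 : ℝ) 1 | ρ (γ 0) (γ t) ≤ C * (t * D)} :=
    isClosed_Icc.isClosed_le hcont (by fun_prop)
  obtain ⟨T, ⟨hT, hTle⟩, hmax⟩ :=
    (isCompact_Icc.of_isClosed_subset hclosed (Set.sep_subset _ _)).exists_isGreatest
      ⟨0, by simp, by simp [h0]⟩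
  rcases hT.2.eq_or_lt with rfl | hlt
  · rwa [dist_start 1 hT]
  · obtain ⟨u, hu, hle⟩ := hstep T ⟨hT.1, hlt⟩
    have huI : u ∈ Set.Icc (0 : ℝ) 1 := ⟨hT.1.trans hu.1.le, hu.2⟩
    rw [hgeo T hT u huI, abs_sub_comm, abs_of_pos (sub_pos.2 hu.1)] at hle
    refine absurd (hmax ⟨huI, ?_⟩) hu.1.not_ge
    linarith [htri (γ 0) (γ T) (γ u)]
end

section
/- Let (X,d) and (Y,ρ) be metric spaces, Π : X → Y a continuous map, γ : [0,1] → X a continuous path, r > 0, a ≥ 0, and N ∈ ℕ. Suppose that ρ(Π(γ(0)), Π(γ(1))) ≥ N·r, and that for all 0 ≤ s ≤ t ≤ 1 with ρ(Π(γ(s)), Π(γ(t))) ≥ r the d-length of the restriction of γ to [s,t] is at least a. Then the d-length of γ is at least N·a. -/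
open scoped ENNReal

/-- The length of a path `γ` on the interval `[a,b]`, measured with respect to an
arbitrary `[0,∞]`-valued function `e` on pairs of points: the supremum over finite
partitions `a = t₀ ≤ t₁ ≤ ⋯ ≤ tₙ = b` of `∑ e (γ tᵢ₋₁) (γ tᵢ)`. -/
noncomputable def elengthOn {X : Type*} (e : X → X → ℝ≥0∞) (γ : ℝ → X) (a b : ℝ) : ℝ≥0∞ :=
  ⨆ (n : ℕ) (t : Fin (n + 1) → ℝ) (_ : Monotone t) (_ : t 0 = a) (_ : t (Fin.last n) = b),
    ∑ i : Fin n, e (γ (t i.castSucc)) (γ (t i.succ))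

/-- A monotone sequence from `a` to `b` gives a lower bound for the length on `[a,b]`. -/
theorem sum_range_le_elengthOn {X : Type*} (e : X → X → ℝ≥0∞) (γ : ℝ → X) {u : ℕ → ℝ}
    (hu : Monotone u) (n : ℕ) :
    ∑ i ∈ Finset.range n, e (γ (u i)) (γ (u (i + 1))) ≤ elengthOn e γ (u 0) (u n) := by
  refine le_iSup_of_le n <| le_iSup_of_le (fun i => u i) <|
    le_iSup_of_le (fun i j hij => hu hij) <| le_iSup_of_le (by simp) <|
    le_iSup_of_le (by simp) ?_
  rw [Finset.sum_range]
  simp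

/-- The length for the extended distance on `[a,b]` is the variation. -/
theorem elengthOn_edist_eq_eVariationOn {X : Type*} [PseudoEMetricSpace X] (γ : ℝ → X) (a b : ℝ) :
    elengthOn (fun x y => edist x y) γ a b = eVariationOn γ (Set.Icc a b) := by
  apply le_antisymm
  · refine iSup_le fun n => iSup_le fun t => iSup_le fun ht => iSup_le fun h0 => iSup_le fun h1 => ?_
    let u : ℕ → ℝ := fun i => t ⟨min i n, by omega⟩
    have hu : Monotone u := fun i j hij => ht (by
      simp only [Fin.mk_le_mk]
      exact min_le_min_right n hij)
    have hmem : ∀ i, u i ∈ Set.Icc a b := fun i =>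
      ⟨h0 ▸ ht (Fin.zero_le _), h1 ▸ ht (Fin.le_last _)⟩
    refine le_trans (le_of_eq ?_) (eVariationOn.sum_le (f := γ) (n := n) hu hmem)
    rw [Finset.sum_range]
    refine Finset.sum_congr rfl fun i _ => ?_
    have hi : u i = t i.castSucc := congrArg t (Fin.ext (min_eq_left i.2.le))
    have hi' : u (i + 1) = t i.succ := congrArg t (Fin.ext (min_eq_left i.2))
    rw [hi, hi', edist_comm]
  · refine iSup_le fun p => ?_
    obtain ⟨n, u, hu, hmem⟩ := p
    let w : ℕ → ℝ := fun i => if i = 0 then a else if i ≤ n + 1 then u (i - 1) else b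
    have hw : Monotone w := by
      refine monotone_nat_of_le_succ fun i => ?_
      rcases Nat.eq_zero_or_pos i with rfl | hi
      · simpa [w] using (hmem 0).1
      · by_cases h : i ≤ n
        · simpa [w, hi.ne', h, h.trans n.le_succ] using hu (Nat.sub_le i 1)
        · by_cases h' : i ≤ n + 1
          · simpa [w, hi.ne', h, h'] using (hmem (i - 1)).2
          · simp [w, hi.ne', h, h']
    have key := sum_range_le_elengthOn (fun x y : X => edist x y) γ hw (n + 2)
    have h0 : w 0 = a := by simp [w]
    have h1 : w (n + 2) = b := by simp [w]
    rw [h0, h1, Finset.sum_range_succ, Finset.sum_range_succ'] at key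
    refine le_trans (le_of_eq ?_) ((le_self_add.trans le_self_add).trans key)
    refine Finset.sum_congr rfl fun i hi => ?_
    have hi := Finset.mem_range.mp hi
    have e1 : w (i + 1) = u i := by simp [w, hi.le]
    have e2 : w (i + 1 + 1) = u (i + 1) := by simp [w, Nat.succ_le_of_lt hi]
    rw [e1, e2, edist_comm]

/-- Length is additive under concatenation of intervals. -/
theorem elengthOn_edist_add {X : Type*} [PseudoEMetricSpace X] (γ : ℝ → X) {a b c : ℝ}
    (hab : a ≤ b) (hbc : b ≤ c) :
    elengthOn (fun x y => edist x y) γ a b + elengthOn (fun x y => edist x y) γ b c =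
      elengthOn (fun x y => edist x y) γ a c := by
  simp only [elengthOn_edist_eq_eVariationOn]
  simpa using eVariationOn.Icc_add_Icc γ (s := Set.univ) hab hbc (Set.mem_univ b)

/-- If `g` is continuous on `[s,b]` and moves by at least `N·r`, and each subinterval on whose
endpoints `g` moves by at least `r` contributes `γ`-length at least `a`, then the `γ`-length of
`[s,b]` is at least `N·a`. -/
theorem mul_le_elengthOn_of_crossings {X Y : Type*} [PseudoEMetricSpace X] [PseudoMetricSpace Y]
    (γ : ℝ → X) (g : ℝ → Y) {r : ℝ} (hr : 0 ≤ r) (a : ℝ≥0∞) (N : ℕ) {s b : ℝ} (hsb : s ≤ b)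
    (hg : ContinuousOn g (Set.Icc s b)) (hfar : (N : ℝ) * r ≤ dist (g s) (g b))
    (hcross : ∀ u v : ℝ, s ≤ u → u ≤ v → v ≤ b → r ≤ dist (g u) (g v) →
      a ≤ elengthOn (fun x y => edist x y) γ u v) :
    (N : ℝ≥0∞) * a ≤ elengthOn (fun x y => edist x y) γ s b := by
  induction N generalizing s with
  | zero => simp
  | succ N ih =>
    push_cast at hfar ⊢
    have hNr : 0 ≤ (N : ℝ) * r := by positivity
    have hcont : ContinuousOn (fun t => dist (g s) (g t)) (Set.Icc s b) :=
      (continuous_const.dist continuous_id).comp_continuousOn hg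
    obtain ⟨t, ⟨hst, htb⟩, ht⟩ : r ∈ (fun t => dist (g s) (g t)) '' Set.Icc s b :=
      intermediate_value_Icc hsb hcont ⟨by simpa using hr, by linarith⟩
    have ht : dist (g s) (g t) = r := ht
    have htri := dist_triangle (g s) (g t) (g b)
    have hrest := ih htb (hg.mono (Set.Icc_subset_Icc_left hst)) (by linarith)
      fun u v hu => hcross u v (hst.trans hu)
    rw [← elengthOn_edist_add γ hst htb, add_mul, one_mul, add_comm]
    exact add_le_add (hcross s t le_rfl hst htb ht.ge) hrest

/-- If the images under `Π` of the endpoints of `γ` are at distance at least `N·r`, and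
every subpath of `γ` whose `Π`-images of endpoints are at distance at least `r` has
`d`-length at least `a`, then `γ` has `d`-length at least `N·a`. -/
theorem length_ge_of_crossings {X Y : Type*} [MetricSpace X] [MetricSpace Y]
    (f : X → Y) (hf : Continuous f)
    (γ : ℝ → X) (hγ : ContinuousOn γ (Set.Icc 0 1))
    (r : ℝ) (hr : 0 < r) (a : ℝ≥0∞) (N : ℕ)
    (hfar : (N : ℝ) * r ≤ dist (f (γ 0)) (f (γ 1)))
    (hcross : ∀ s t : ℝ, 0 ≤ s → s ≤ t → t ≤ 1 →
      r ≤ dist (f (γ s)) (f (γ t)) →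
      a ≤ elengthOn (fun x y => edist x y) γ s t) :
    (N : ℝ≥0∞) * a ≤ elengthOn (fun x y => edist x y) γ 0 1 := by
  exact mul_le_elengthOn_of_crossings γ (f ∘ γ) hr.le a N zero_le_one
    (hf.comp_continuousOn hγ) hfar hcross
end
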